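/- Let μ₁, μ₂ be Borel probability measures on ℝ with finite first moments, let Φ : ℝ² → (−∞,∞] be measurable with Φ(s₁,s₂) ≥ −K(1+|s₁|+|s₂|), let u₂ : ℝ → ℝ be μ₂-integrable, and let Q ∈ M(μ₁, μ₂) satisfy ∫ Φ dQ < ∞. Then ∫ Φ(s₁,s₂) dQ(s₁,s₂) ≥ ∫ (Φ(s₁,·) − u₂)**(s₁) dμ₁(s₁) + ∫ u₂ dμ₂, where (Φ(s₁,·) − u₂)** is the convex envelope in the second variable, evaluated at s₁. -/

import Mathlib

open MeasureTheory
open scoped BigOperators ENNReal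

noncomputable section

namespace MOT2

/-- `Q ∈ M(μ₁, μ₂)`: `Q` is a Borel probability measure on `ℝ²` with marginals `μ₁, μ₂`
under which the coordinate process `(S₁, S₂)` is a martingale, i.e.
`∫ Δ(s₁)(s₂ - s₁) dQ = 0` for every bounded measurable `Δ : ℝ → ℝ`. -/
def IsMartingaleCoupling (Q : Measure (ℝ × ℝ)) (μ₁ μ₂ : Measure ℝ) : Prop :=
  IsProbabilityMeasure Q ∧ Q.map Prod.fst = μ₁ ∧ Q.map Prod.snd = μ₂ ∧
    ∀ Δ : ℝ → ℝ, Measurable Δ → (∃ C, ∀ x, |Δ x| ≤ C) →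
      ∫ p : ℝ × ℝ, Δ p.1 * (p.2 - p.1) ∂Q = 0

/-- The positive part of an extended real, as an element of `ℝ≥0∞`. -/
def toENN (a : EReal) : ℝ≥0∞ := if a = ⊤ then ⊤ else ENNReal.ofReal a.toReal

/-- Extended integral of an `EReal`-valued function: positive part minus negative part. -/
def eInt {α : Type*} [MeasurableSpace α] (Φ : α → EReal) (π : Measure α) : EReal :=
  ((∫⁻ x, toENN (Φ x) ∂π : ℝ≥0∞) : EReal) - ((∫⁻ x, toENN (-(Φ x)) ∂π : ℝ≥0∞) : EReal)

/-- Convexity for `EReal`-valued functions on `ℝ`. -/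
def EConvexOn (h : ℝ → EReal) : Prop :=
  ∀ x y : ℝ, ∀ t : ℝ, 0 ≤ t → t ≤ 1 →
    h (t * x + (1 - t) * y) ≤ (t : EReal) * h x + ((1 - t : ℝ) : EReal) * h y

/-- The convex envelope `g**` of `g : ℝ → EReal`: the pointwise supremum of all convex
functions lying below `g`, i.e. the largest convex function `≤ g`. -/
def convexEnvelope (g : ℝ → EReal) (x : ℝ) : EReal :=
  ⨆ h : {h : ℝ → EReal // EConvexOn h ∧ ∀ y, h y ≤ g y}, (h : ℝ → EReal) x

end MOT2

namespace MOT2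

lemma toENN_eq_toENNReal : toENN = EReal.toENNReal := rfl

lemma eInt_mono_ae {α : Type*} [MeasurableSpace α] {π : Measure α} {f g : α → EReal}
    (h : ∀ᵐ x ∂π, f x ≤ g x) : eInt f π ≤ eInt g π := by
  refine EReal.sub_le_sub ?_ ?_
  · refine EReal.coe_ennreal_le_coe_ennreal_iff.2 (lintegral_mono_ae ?_)
    filter_upwards [h] with x hx using EReal.toENNReal_le_toENNReal hx
  · refine EReal.coe_ennreal_le_coe_ennreal_iff.2 (lintegral_mono_ae ?_)
    filter_upwards [h] with x hx using EReal.toENNReal_le_toENNReal (EReal.neg_le_neg_iff.2 hx)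

lemma eInt_congr_ae {α : Type*} [MeasurableSpace α] {π : Measure α} {f g : α → EReal}
    (h : f =ᵐ[π] g) : eInt f π = eInt g π :=
  le_antisymm (eInt_mono_ae h.le) (eInt_mono_ae h.symm.le)

/-- On integrable real-valued functions the extended integral is the Bochner integral. -/
lemma eInt_coe {α : Type*} [MeasurableSpace α] {π : Measure α} {g : α → ℝ}
    (hg : Integrable g π) : eInt (fun x => (g x : EReal)) π = ((∫ x, g x ∂π : ℝ) : EReal) := by
  have hpos : ∫⁻ x, ENNReal.ofReal (g x) ∂π ≠ ⊤ := hg.lintegral_lt_top.ne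
  have hneg : ∫⁻ x, ENNReal.ofReal (-g x) ∂π ≠ ⊤ := hg.neg.lintegral_lt_top.ne
  have hrw : ∀ x, toENN (-(g x : EReal)) = ENNReal.ofReal (-g x) := fun x => by
    rw [toENN_eq_toENNReal, ← EReal.coe_neg, EReal.real_coe_toENNReal]
  simp only [eInt, hrw]
  rw [integral_eq_lintegral_pos_part_sub_lintegral_neg_part hg, EReal.coe_sub,
    EReal.coe_ennreal_toReal hpos, EReal.coe_ennreal_toReal hneg]
  rfl

/-- If the height `a` at `s` lies below every chord of `g` between points of `A` on either side of
`s`, then some line through `(s, a)` lies below `g` on `A`. -/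
lemma exists_affine_le {A : Set ℝ} {g : ℝ → ℝ} {s a : ℝ}
    (hcomb : ∀ x ∈ A, ∀ y ∈ A, x < s → s < y →
      a * (y - x) ≤ (y - s) * g x + (s - x) * g y)
    (hs : s ∈ A → a ≤ g s) (hleft : ∃ x ∈ A, x < s) (hright : ∃ y ∈ A, s < y) :
    ∃ c : ℝ, ∀ y ∈ A, a + c * (y - s) ≤ g y := by
  set L : Set ℝ := (fun x => (a - g x) / (s - x)) '' {x | x ∈ A ∧ x < s}
  have hub : ∀ y ∈ A, s < y → (g y - a) / (y - s) ∈ upperBounds L := by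
    rintro y hy hsy _ ⟨x, ⟨hx, hxs⟩, rfl⟩
    have := hcomb x hx y hy hxs hsy
    dsimp only
    rw [div_le_div_iff₀ (by linarith) (by linarith)]
    linarith
  obtain ⟨y₀, hy₀, hsy₀⟩ := hright
  obtain ⟨x₀, hx₀, hxs₀⟩ := hleft
  refine ⟨sSup L, fun y hy => ?_⟩
  rcases lt_trichotomy y s with h | h | h
  · have hle := le_csSup ⟨_, hub y₀ hy₀ hsy₀⟩ (Set.mem_image_of_mem _ ⟨hy, h⟩ :
      (a - g y) / (s - y) ∈ L)
    rw [div_le_iff₀ (by linarith)] at hle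
    linarith
  · subst h
    simpa using hs hy
  · have hle := csSup_le (Set.Nonempty.image _ ⟨x₀, hx₀, hxs₀⟩ : L.Nonempty) (hub y hy h)
    rw [le_div_iff₀ (by linarith)] at hle
    linarith

/-- Jensen's inequality for an extended-real convex function dominated by an integrable one. -/
lemma EConvexOn.le_integral {h : ℝ → EReal} (hh : EConvexOn h) {ν : Measure ℝ}
    [IsProbabilityMeasure ν] {s : ℝ} (hid : Integrable (fun y : ℝ => y) ν)
    (hmean : ∫ y, y ∂ν = s) {g : ℝ → ℝ} (hg : Integrable g ν)
    (hle : ∀ᵐ y ∂ν, h y ≤ (g y : EReal)) : h s ≤ ((∫ y, g y ∂ν : ℝ) : EReal) := by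
  have hsub : Integrable (fun y : ℝ => y - s) ν := hid.sub (integrable_const s)
  have hcenter : ∫ y, (y - s) ∂ν = 0 := by
    rw [integral_sub hid (integrable_const s), hmean]; simp
  have hconst : (∀ᵐ y ∂ν, y = s) → h s ≤ ((∫ y, g y ∂ν : ℝ) : EReal) := fun hae => by
    have hint : ∫ y, g y ∂ν = g s := by
      rw [integral_congr_ae (g := fun _ => g s) (by filter_upwards [hae] with y hy; rw [hy])]
      simp
    obtain ⟨y, hy, rfl⟩ := (hle.and hae).exists
    rwa [hint]
  by_cases hleft : ∃ x ∈ {y | h y ≤ (g y : EReal)}, x < s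
  swap
  · push Not at hleft
    refine hconst ?_
    have h0 : 0 ≤ᵐ[ν] fun y : ℝ => y - s := by
      filter_upwards [hle] with y hy using sub_nonneg.2 (hleft y hy)
    filter_upwards [(integral_eq_zero_iff_of_nonneg_ae h0 hsub).1 hcenter] with y hy
    exact sub_eq_zero.1 hy
  by_cases hright : ∃ y ∈ {y | h y ≤ (g y : EReal)}, s < y
  swap
  · push Not at hright
    refine hconst ?_
    have h0 : 0 ≤ᵐ[ν] fun y : ℝ => -(y - s) := by
      filter_upwards [hle] with y hy
      have := hright y hy
      simp only [Pi.zero_apply]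
      linarith
    filter_upwards [(integral_eq_zero_iff_of_nonneg_ae h0 hsub.neg).1
      (by rw [integral_neg, hcenter, neg_zero])] with y hy
    simp only [Pi.zero_apply] at hy
    linarith
  refine EReal.ge_of_forall_gt_iff_ge.1 fun a ha => EReal.coe_le_coe_iff.2 ?_
  obtain ⟨c, hc⟩ := exists_affine_le (a := a) (s := s) (g := g) (A := {y | h y ≤ (g y : EReal)})
    (fun x hx y hy hxs hsy => by
      have hyx : 0 < y - x := by linarith
      set t : ℝ := (y - s) / (y - x)
      have ht0 : 0 ≤ t := div_nonneg (by linarith) hyx.le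
      have ht1 : t ≤ 1 := (div_le_one hyx).2 (by linarith)
      have ht' : t * (y - x) = y - s := div_mul_cancel₀ _ hyx.ne'
      have hst : t * x + (1 - t) * y = s := by linarith
      have hconv := hh x y t ht0 ht1
      rw [hst] at hconv
      have hbound : (a : EReal) ≤ ((t * g x + (1 - t) * g y : ℝ) : EReal) := by
        rw [EReal.coe_add, EReal.coe_mul, EReal.coe_mul]
        exact (ha.le.trans hconv).trans (add_le_add
          (mul_le_mul_of_nonneg_left hx (EReal.coe_nonneg.2 ht0))
          (mul_le_mul_of_nonneg_left hy (EReal.coe_nonneg.2 (sub_nonneg.2 ht1))))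
      have := mul_le_mul_of_nonneg_right (EReal.coe_le_coe_iff.1 hbound) hyx.le
      have h1 : (1 - t) * (y - x) = s - x := by linarith
      calc a * (y - x) ≤ _ := this
        _ = (t * (y - x)) * g x + ((1 - t) * (y - x)) * g y := by ring
        _ = _ := by rw [ht', h1])
    (fun hs => EReal.coe_le_coe_iff.1 (ha.le.trans hs)) hleft hright
  calc a = ∫ y, (a + c * (y - s)) ∂ν := by
        rw [integral_add (integrable_const a) (hsub.const_mul c), integral_const_mul, hcenter]
        simp
    _ ≤ ∫ y, g y ∂ν := by
        refine integral_mono_ae ((integrable_const a).add (hsub.const_mul c)) hg ?_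
        filter_upwards [hle] with y hy using hc y hy

/-- Jensen's inequality for the convex envelope. -/
lemma convexEnvelope_le_integral {f : ℝ → EReal} {ν : Measure ℝ} [IsProbabilityMeasure ν]
    {s : ℝ} (hid : Integrable (fun y : ℝ => y) ν) (hmean : ∫ y, y ∂ν = s) {g : ℝ → ℝ}
    (hg : Integrable g ν) (hle : ∀ᵐ y ∂ν, f y ≤ (g y : EReal)) :
    convexEnvelope f s ≤ ((∫ y, g y ∂ν : ℝ) : EReal) :=
  iSup_le fun h => h.2.1.le_integral hid hmean hg <| by
    filter_upwards [hle] with y hy using (h.2.2 y).trans hy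

/-- A measurable extended-real function bounded below by an integrable one, with extended
integral less than `⊤`, is almost everywhere finite and integrable. -/
lemma integrable_toReal_of_eInt_lt_top {α : Type*} [MeasurableSpace α] {π : Measure α}
    {Φ : α → EReal} (hΦ : Measurable Φ) {b : α → ℝ} (hb : Integrable b π)
    (hbΦ : ∀ x, (b x : EReal) ≤ Φ x) (hfin : eInt Φ π < ⊤) :
    Integrable (fun x => (Φ x).toReal) π ∧ ∀ᵐ x ∂π, ((Φ x).toReal : EReal) = Φ x := by
  have hneg : ∫⁻ x, toENN (-Φ x) ∂π ≠ ⊤ := by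
    refine ((lintegral_mono fun x => ?_).trans_lt hb.neg.lintegral_lt_top).ne
    rw [Pi.neg_apply, ← EReal.real_coe_toENNReal, EReal.coe_neg]
    exact EReal.toENNReal_le_toENNReal (EReal.neg_le_neg_iff.2 (hbΦ x))
  have hpos : ∫⁻ x, toENN (Φ x) ∂π ≠ ⊤ := fun htop => by
    rw [eInt, htop, ← EReal.coe_ennreal_toReal hneg, EReal.coe_ennreal_top,
      EReal.top_sub_coe] at hfin
    exact hfin.ne rfl
  have hae : ∀ᵐ x ∂π, ((Φ x).toReal : EReal) = Φ x := by
    filter_upwards [ae_lt_top hΦ.ereal_toENNReal hpos] with x hx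
    exact EReal.coe_toReal (EReal.toENNReal_ne_top_iff.1 hx.ne)
      ((EReal.bot_lt_coe _).trans_le (hbΦ x)).ne'
  refine ⟨⟨hΦ.ereal_toReal.aestronglyMeasurable, ?_⟩, hae⟩
  refine (lintegral_mono_ae (g := fun x => toENN (Φ x) + toENN (-Φ x)) ?_).trans_lt ?_
  · filter_upwards [hae] with x hx
    rw [← hx, ← EReal.coe_neg, toENN_eq_toENNReal, EReal.real_coe_toENNReal,
      EReal.real_coe_toENNReal, EReal.toReal_coe, Real.enorm_eq_ofReal_abs]
    rcases abs_cases (Φ x).toReal with h | h <;> rw [h.1]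
    · exact le_self_add
    · exact le_add_self
  · rw [lintegral_add_left (f := fun x => toENN (Φ x)) hΦ.ereal_toENNReal]
    exact ENNReal.add_lt_top.2 ⟨hpos.lt_top, hneg.lt_top⟩

/-- Under a martingale coupling, almost every conditional law of the second coordinate given the
first has barycentre equal to the first coordinate. -/
lemma IsMartingaleCoupling.ae_condKernel_mean {Q : Measure (ℝ × ℝ)} [IsProbabilityMeasure Q]
    {μ₁ μ₂ : Measure ℝ} (hQ : IsMartingaleCoupling Q μ₁ μ₂)
    (h₁ : Integrable (fun p : ℝ × ℝ => p.1) Q) (h₂ : Integrable (fun p : ℝ × ℝ => p.2) Q) :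
    ∀ᵐ s ∂Q.fst, ∫ y, y ∂Q.condKernel s = s := by
  have hsub : Integrable (fun p : ℝ × ℝ => p.2 - p.1) Q := h₂.sub h₁
  have hzero : (fun s => ∫ y, (y - s) ∂Q.condKernel s) =ᵐ[Q.fst] 0 := by
    refine Integrable.ae_eq_zero_of_forall_setIntegral_eq_zero hsub.integral_condKernel
      fun A hA _ => ?_
    rw [Measure.setIntegral_condKernel_univ_right hA hsub.integrableOn,
      ← integral_indicator (hA.prod MeasurableSet.univ),
      ← hQ.2.2.2 (A.indicator 1) (measurable_one.indicator hA) ⟨1, fun x => ?_⟩]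
    · congr 1 with p
      by_cases hp : p.1 ∈ A <;> simp [hp]
    · by_cases hx : x ∈ A <;> simp [hx]
  filter_upwards [hzero, h₂.condKernel_ae] with s hs hint
  rw [integral_sub hint (integrable_const s)] at hs
  simp only [integral_const, probReal_univ, one_smul, Pi.zero_apply] at hs
  linarith

end MOT2

/-- **The easy inequality of Proposition 4.4.** For measurable `Φ : ℝ² → (-∞, ∞]` with
`Φ(s₁, s₂) ≥ -K (1 + |s₁| + |s₂|)`, a `μ₂`-integrable `u₂ : ℝ → ℝ` and a martingale
coupling `Q ∈ M(μ₁, μ₂)` with `∫ Φ dQ < ∞`,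
`∫ Φ dQ ≥ ∫ (Φ(s₁, ·) - u₂)**(s₁) dμ₁(s₁) + ∫ u₂ dμ₂`, where `(Φ(s₁, ·) - u₂)**` is the
convex envelope in the second variable. -/
theorem c_convex_lower_bound (μ₁ μ₂ : Measure ℝ)
    (hprob₁ : IsProbabilityMeasure μ₁) (hprob₂ : IsProbabilityMeasure μ₂)
    (hmom₁ : Integrable (fun x : ℝ => x) μ₁) (hmom₂ : Integrable (fun x : ℝ => x) μ₂)
    (Φ : ℝ × ℝ → EReal) (hΦmeas : Measurable Φ)
    (K : ℝ) (hK : ∀ s₁ s₂ : ℝ, ((-(K * (1 + |s₁| + |s₂|)) : ℝ) : EReal) ≤ Φ (s₁, s₂))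
    (u₂ : ℝ → ℝ) (hu₂ : Integrable u₂ μ₂)
    (Q : Measure (ℝ × ℝ)) (hQ : MOT2.IsMartingaleCoupling Q μ₁ μ₂)
    (hfin : MOT2.eInt Φ Q < ⊤) :
    MOT2.eInt
        (fun s₁ => MOT2.convexEnvelope
          (fun s₂ => Φ (s₁, s₂) - ((u₂ s₂ : ℝ) : EReal)) s₁) μ₁ +
      ((∫ s, u₂ s ∂μ₂ : ℝ) : EReal) ≤ MOT2.eInt Φ Q := by
  have : IsProbabilityMeasure Q := hQ.1
  have hfst : Q.fst = μ₁ := hQ.2.1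
  have h₁ : Integrable (fun p : ℝ × ℝ => p.1) Q :=
    Integrable.comp_measurable (g := fun x : ℝ => x) (by rwa [hQ.2.1]) measurable_fst
  have h₂ : Integrable (fun p : ℝ × ℝ => p.2) Q :=
    Integrable.comp_measurable (g := fun x : ℝ => x) (by rwa [hQ.2.2.1]) measurable_snd
  have hu : Integrable (fun p : ℝ × ℝ => u₂ p.2) Q :=
    Integrable.comp_measurable (g := u₂) (by rwa [hQ.2.2.1]) measurable_snd
  have hu_eq : ∫ p : ℝ × ℝ, u₂ p.2 ∂Q = ∫ s, u₂ s ∂μ₂ := by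
    rw [← hQ.2.2.1, integral_map measurable_snd.aemeasurable]
    rw [hQ.2.2.1]
    exact hu₂.1
  obtain ⟨hφ, hae⟩ := MOT2.integrable_toReal_of_eInt_lt_top hΦmeas
    ((((integrable_const 1).add h₁.abs).add h₂.abs).const_mul K).neg
    (fun p => hK p.1 p.2) hfin
  have hG : Integrable (fun p : ℝ × ℝ => (Φ p).toReal - u₂ p.2) Q := hφ.sub hu
  have hae' : ∀ᵐ s ∂Q.fst, ∀ᵐ y ∂Q.condKernel s, ((Φ (s, y)).toReal : EReal) = Φ (s, y) := by
    rw [← Q.disintegrate Q.condKernel] at hae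
    exact Measure.ae_ae_of_ae_compProd hae
  have hbound : ∀ᵐ s ∂μ₁, MOT2.convexEnvelope (fun y => Φ (s, y) - ((u₂ y : ℝ) : EReal)) s ≤
      ((∫ y, ((Φ (s, y)).toReal - u₂ y) ∂Q.condKernel s : ℝ) : EReal) := by
    rw [← hfst]
    filter_upwards [hae', hG.condKernel_ae, h₂.condKernel_ae, hQ.ae_condKernel_mean h₁ h₂]
      with s hs hGs hid hmean
    refine MOT2.convexEnvelope_le_integral hid hmean hGs ?_
    filter_upwards [hs] with y hy
    rw [EReal.coe_sub, hy]
  have hGint : Integrable (fun s => ∫ y, ((Φ (s, y)).toReal - u₂ y) ∂Q.condKernel s) μ₁ :=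
    hfst ▸ hG.integral_condKernel
  have hGval : ∫ s, ∫ y, ((Φ (s, y)).toReal - u₂ y) ∂Q.condKernel s ∂μ₁ =
      ∫ p, (Φ p).toReal ∂Q - ∫ s, u₂ s ∂μ₂ := by
    rw [← hu_eq, ← integral_sub hφ hu, ← hfst]
    exact Measure.integral_condKernel hG
  have hΦval : MOT2.eInt Φ Q = ((∫ p, (Φ p).toReal ∂Q : ℝ) : EReal) := by
    rw [← MOT2.eInt_coe hφ]
    exact MOT2.eInt_congr_ae (Filter.EventuallyEq.symm hae)
  calc _ ≤ MOT2.eInt (fun s =>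
          ((∫ y, ((Φ (s, y)).toReal - u₂ y) ∂Q.condKernel s : ℝ) : EReal)) μ₁ +
        ((∫ s, u₂ s ∂μ₂ : ℝ) : EReal) := add_le_add_left (MOT2.eInt_mono_ae hbound) _
    _ = MOT2.eInt Φ Q := by
      rw [MOT2.eInt_coe hGint, hGval, hΦval, ← EReal.coe_add, sub_add_cancel]
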